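/- Under the stated hypotheses, there exist positive constants δ₀, ε₀ and C, depending only on p, μ, κ, s, c₁, C₁, v₋, v₊ and independent of α, β and T, such that if δ ≤ δ₀ and ε ≤ ε₀ then for all t ∈ [0, T]: |∫₀^t (φ_xx ψ/(p'(V)v⁵))(0,τ) dτ| + |∫₀^t (φ_x φ_xx/v⁵)(0,τ) dτ| + |∫₀^t (φ_xx ψ_xx/v⁵)(0,τ) dτ| + |∫₀^t (ψ_t φ_xx)(0,τ) dτ| ≤ C e^{−c₁β}. -/

import Mathlib

open MeasureTheory Filter Set Real

/-- Spatial partial derivative `∂f/∂x` of a function `f(x,t)`. -/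
noncomputable def pdx (f : ℝ → ℝ → ℝ) : ℝ → ℝ → ℝ := fun x t => deriv (fun y => f y t) x

/-- Temporal partial derivative `∂f/∂t` of a function `f(x,t)`. -/
noncomputable def pdt (f : ℝ → ℝ → ℝ) : ℝ → ℝ → ℝ := fun x t => deriv (fun r => f x r) t

/-- `‖f(·,t)‖²`, the squared `L²(0,∞)` norm in `x` at time `t`. -/
noncomputable def sqnorm (f : ℝ → ℝ → ℝ) (t : ℝ) : ℝ := ∫ x in Set.Ioi (0:ℝ), (f x t) ^ 2

/-- `‖f(·,t)‖ₖ²`, the squared `Hᵏ(0,∞)` Sobolev norm in `x` at time `t`. -/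
noncomputable def Hsq (k : ℕ) (f : ℝ → ℝ → ℝ) (t : ℝ) : ℝ :=
  ∑ j ∈ Finset.range (k + 1), sqnorm (pdx^[j] f) t

/-- The nonlinear source term `F` of the reformulated Navier–Stokes–Korteweg system,
where the shock profile `(V, U)` is evaluated at `ξ = x − st + α − β` and
`v = V + φ_x`. -/
noncomputable def NSKF (p : ℝ → ℝ) (μ κ s α β : ℝ) (V U : ℝ → ℝ)
    (φ ψ : ℝ → ℝ → ℝ) (x t : ℝ) : ℝ :=
  -(p (V (x - s*t + α - β) + pdx φ x t) - p (V (x - s*t + α - β))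
      - deriv p (V (x - s*t + α - β)) * pdx φ x t)
  - μ * pdx (pdx ψ) x t * pdx φ x t
      / ((V (x - s*t + α - β) + pdx φ x t) * V (x - s*t + α - β))
  + κ * deriv (deriv V) (x - s*t + α - β)
      * (1 / (V (x - s*t + α - β)) ^ 5 - 1 / (V (x - s*t + α - β) + pdx φ x t) ^ 5)
  + (5 * κ / 2) * ((pdx (pdx φ) x t) ^ 2 + 2 * pdx (pdx φ) x t * deriv V (x - s*t + α - β))
      / (V (x - s*t + α - β) + pdx φ x t) ^ 6
  + (5 * κ / 2) * (deriv V (x - s*t + α - β)) ^ 2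
      * (1 / (V (x - s*t + α - β)) ^ 6 - 1 / (V (x - s*t + α - β) + pdx φ x t) ^ 6)
  + μ * deriv U (x - s*t + α - β) * (pdx φ x t) ^ 2
      / ((V (x - s*t + α - β) + pdx φ x t) * (V (x - s*t + α - β)) ^ 2)

open ContDiff in
theorem hasDerivAt_pdx {f : ℝ → ℝ → ℝ} (hf : ContDiff ℝ ∞ (Function.uncurry f)) (x t : ℝ) :
    HasDerivAt (fun y => f y t) (fderiv ℝ (Function.uncurry f) (x, t) (1, 0)) x := by
  have h := (hf.differentiable (by simp) (x, t)).hasFDerivAt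
  exact h.comp_hasDerivAt x ((hasDerivAt_id x).prodMk (hasDerivAt_const x t))

open ContDiff in
theorem hasDerivAt_pdt {f : ℝ → ℝ → ℝ} (hf : ContDiff ℝ ∞ (Function.uncurry f)) (x t : ℝ) :
    HasDerivAt (fun r => f x r) (fderiv ℝ (Function.uncurry f) (x, t) (0, 1)) t := by
  have h := (hf.differentiable (by simp) (x, t)).hasFDerivAt
  exact h.comp_hasDerivAt t ((hasDerivAt_const t x).prodMk (hasDerivAt_id t))

open ContDiff in
theorem uncurry_pdx {f : ℝ → ℝ → ℝ} (hf : ContDiff ℝ ∞ (Function.uncurry f)) :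
    Function.uncurry (pdx f) = fun q => fderiv ℝ (Function.uncurry f) q (1, 0) := by
  ext ⟨x, t⟩
  exact (hasDerivAt_pdx hf x t).deriv

open ContDiff in
theorem uncurry_pdt {f : ℝ → ℝ → ℝ} (hf : ContDiff ℝ ∞ (Function.uncurry f)) :
    Function.uncurry (pdt f) = fun q => fderiv ℝ (Function.uncurry f) q (0, 1) := by
  ext ⟨x, t⟩
  exact (hasDerivAt_pdt hf x t).deriv

open ContDiff in
theorem contDiff_pdx {f : ℝ → ℝ → ℝ} (hf : ContDiff ℝ ∞ (Function.uncurry f)) :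
    ContDiff ℝ ∞ (Function.uncurry (pdx f)) := by
  rw [uncurry_pdx hf]
  exact (hf.fderiv_right (m := ∞) (by simp)).clm_apply contDiff_const

open ContDiff in
theorem contDiff_pdt {f : ℝ → ℝ → ℝ} (hf : ContDiff ℝ ∞ (Function.uncurry f)) :
    ContDiff ℝ ∞ (Function.uncurry (pdt f)) := by
  rw [uncurry_pdt hf]
  exact (hf.fderiv_right (m := ∞) (by simp)).clm_apply contDiff_const

open ContDiff in
/-- Mixed partial derivatives of a smooth function commute. -/
theorem pdt_pdx_comm {f : ℝ → ℝ → ℝ} (hf : ContDiff ℝ ∞ (Function.uncurry f)) (x t : ℝ) :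
    pdt (pdx f) x t = pdx (pdt f) x t := by
  have hd : DifferentiableAt ℝ (fderiv ℝ (Function.uncurry f)) (x, t) :=
    (hf.fderiv_right (m := ∞) (by simp)).differentiable (by simp) (x, t)
  have h1 := (hasDerivAt_pdt (contDiff_pdx hf) x t).deriv
  have h2 := (hasDerivAt_pdx (contDiff_pdt hf) x t).deriv
  have key : ∀ a b : ℝ × ℝ, fderiv ℝ (fun q => fderiv ℝ (Function.uncurry f) q a) (x, t) b
      = fderiv ℝ (fderiv ℝ (Function.uncurry f)) (x, t) b a := by
    intro a b
    rw [fderiv_clm_apply hd (differentiableAt_const a)]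
    simp
  rw [uncurry_pdx hf, key] at h1
  rw [uncurry_pdt hf, key] at h2
  have hsymm : IsSymmSndFDerivAt ℝ (Function.uncurry f) (x, t) :=
    hf.contDiffAt.isSymmSndFDerivAt (by simpa using WithTop.coe_le_coe.2 (le_top : (2 : ℕ∞) ≤ ⊤))
  change deriv _ _ = deriv _ _
  rw [h1, h2, hsymm]

open ContDiff in
/-- If `φ_t = ψ_x` in the open quadrant strip, then `φ_xt = ψ_xx` up to the boundary. -/
theorem pdt_pdx_eq_of_conservation {φ ψ : ℝ → ℝ → ℝ} {T : ℝ} (hT : 0 < T)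
    (hφ : ContDiff ℝ ∞ (Function.uncurry φ)) (hψ : ContDiff ℝ ∞ (Function.uncurry ψ))
    (h : ∀ x ∈ Set.Ioi (0:ℝ), ∀ t ∈ Set.Ioo (0:ℝ) T, pdt φ x t - pdx ψ x t = 0)
    {t : ℝ} (ht : t ∈ Set.Icc 0 T) : pdt (pdx φ) 0 t = pdx (pdx ψ) 0 t := by
  have hopen : Set.EqOn (Function.uncurry (pdt (pdx φ))) (Function.uncurry (pdx (pdx ψ)))
      (Set.Ioi (0:ℝ) ×ˢ Set.Ioo (0:ℝ) T) := by
    rintro ⟨x, r⟩ ⟨hx, hr⟩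
    change pdt (pdx φ) x r = pdx (pdx ψ) x r
    rw [pdt_pdx_comm hφ]
    refine Filter.EventuallyEq.deriv_eq ?_
    filter_upwards [Ioi_mem_nhds hx] with y hy
    exact sub_eq_zero.mp (h y hy r hr)
  have hcl := hopen.closure (contDiff_pdt (contDiff_pdx hφ)).continuous
    (contDiff_pdx (contDiff_pdx hψ)).continuous
  rw [closure_prod_eq, closure_Ioi, closure_Ioo hT.ne] at hcl
  exact hcl (Set.mk_mem_prod Set.self_mem_Ici ht : ((0:ℝ), t) ∈ _)

/-- One-dimensional Sobolev trace inequality on the half line. -/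
theorem sq_zero_le_integral_sq_add {f f' : ℝ → ℝ} (hd : ∀ x, HasDerivAt f (f' x) x)
    (hc : Continuous f') (hf : IntegrableOn (fun x => f x ^ 2) (Set.Ioi 0))
    (hf' : IntegrableOn (fun x => f' x ^ 2) (Set.Ioi 0)) (hlim : Tendsto f atTop (nhds 0)) :
    f 0 ^ 2 ≤ (∫ x in Set.Ioi (0:ℝ), f x ^ 2) + ∫ x in Set.Ioi (0:ℝ), f' x ^ 2 := by
  have hfc : Continuous f := continuous_iff_continuousAt.2 fun x => (hd x).continuousAt
  have hle : ∀ x, ‖2 * f x * f' x‖ ≤ f x ^ 2 + f' x ^ 2 := fun x => by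
    rw [Real.norm_eq_abs, abs_le]
    constructor <;> nlinarith [sq_nonneg (f x + f' x), sq_nonneg (f x - f' x)]
  have hint : IntegrableOn (fun x => 2 * f x * f' x) (Set.Ioi 0) :=
    Integrable.mono' (hf.add hf')
      (by fun_prop : Continuous fun x => 2 * f x * f' x).aestronglyMeasurable
      (Filter.Eventually.of_forall hle)
  have hFTC : ∫ x in Set.Ioi (0:ℝ), 2 * f x * f' x = 0 - f 0 ^ 2 := by
    refine integral_Ioi_of_hasDerivAt_of_tendsto' (f := fun x => f x ^ 2)
      (fun x _ => ?_) hint ?_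
    · simpa using (hd x).fun_pow 2
    · simpa using hlim.pow 2
  rw [← integral_add hf hf']
  have h1 := norm_integral_le_of_norm_le (hf.add hf') (Filter.Eventually.of_forall hle)
  rw [hFTC, Real.norm_eq_abs, zero_sub, abs_neg, abs_of_nonneg (sq_nonneg _)] at h1
  exact h1

theorem sqnorm_nonneg (f : ℝ → ℝ → ℝ) (t : ℝ) : 0 ≤ sqnorm f t :=
  integral_nonneg fun _ => sq_nonneg _

open ContDiff in
/-- The boundary value of a derivative of order `j < k` is controlled by the `Hᵏ` norm. -/
theorem abs_pdx_iterate_zero_le_one {f : ℝ → ℝ → ℝ} {j k : ℕ} (hjk : j < k) {t : ℝ}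
    (hj : ContDiff ℝ ∞ (Function.uncurry (pdx^[j] f)))
    (h0 : IntegrableOn (fun x => (pdx^[j] f x t) ^ 2) (Set.Ioi 0))
    (h1 : IntegrableOn (fun x => (pdx^[j + 1] f x t) ^ 2) (Set.Ioi 0))
    (hlim : Tendsto (fun x => pdx^[j] f x t) atTop (nhds 0)) (hH : Hsq k f t ≤ 1) :
    |pdx^[j] f 0 t| ≤ 1 := by
  have hstep : pdx^[j + 1] f = pdx (pdx^[j] f) := Function.iterate_succ_apply' _ _ _
  have hS := sq_zero_le_integral_sq_add (f := fun x => pdx^[j] f x t)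
    (f' := fun x => pdx^[j + 1] f x t)
    (fun x => by
      rw [hstep]; exact (hasDerivAt_pdx hj x t).differentiableAt.hasDerivAt)
    (by
      rw [hstep]
      exact (contDiff_pdx hj).continuous.comp (by fun_prop : Continuous fun x : ℝ => (x, t)))
    h0 h1 hlim
  have hsub : ({j, j + 1} : Finset ℕ) ⊆ Finset.range (k + 1) := by
    intro i hi
    simp only [Finset.mem_insert, Finset.mem_singleton, Finset.mem_range] at hi ⊢
    omega
  have hsum := Finset.sum_le_sum_of_subset_of_nonneg hsub
    (f := fun i => sqnorm (pdx^[i] f) t) (fun i _ _ => sqnorm_nonneg _ _)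
  rw [Finset.sum_pair (by omega)] at hsum
  rw [← sq_le_one_iff_abs_le_one]
  exact hS.trans (hsum.trans hH)

theorem intervalIntegral_exp_decay_le {a t : ℝ} (ha : 0 < a) :
    ∫ τ in (0:ℝ)..t, Real.exp (-(a * τ)) ≤ 1 / a := by
  have h : ∫ τ in (0:ℝ)..t, Real.exp (-(a * τ))
      = -Real.exp (-(a * t)) / a - -Real.exp (-(a * 0)) / a := by
    refine intervalIntegral.integral_eq_sub_of_hasDerivAt
      (f := fun τ => -Real.exp (-(a * τ)) / a) (fun τ _ => ?_)
      ((by fun_prop : Continuous fun τ : ℝ => Real.exp (-(a * τ))).intervalIntegrable _ _)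
    have h1 : HasDerivAt (fun τ : ℝ => -(a * τ)) (-a) τ := by
      simpa using ((hasDerivAt_id τ).const_mul a).fun_neg
    exact (h1.exp.fun_neg.div_const a).congr_deriv (by field_simp)
  rw [h, mul_zero, neg_zero, Real.exp_zero, neg_div, neg_div, sub_neg_eq_add]
  have : 0 ≤ Real.exp (-(a * t)) / a := by positivity
  linarith

/-- The integral of an exponentially decaying function is bounded uniformly in time. -/
theorem abs_integral_le_of_exp_decay {a t A : ℝ} {g : ℝ → ℝ} (ha : 0 < a) (ht : 0 ≤ t)
    (hA : 0 ≤ A) (hg : ∀ τ ∈ Set.Icc 0 t, |g τ| ≤ A * Real.exp (-(a * τ))) :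
    |∫ τ in (0:ℝ)..t, g τ| ≤ A / a := by
  have h := intervalIntegral.norm_integral_le_of_norm_le (μ := volume) (f := g)
    (g := fun τ => A * Real.exp (-(a * τ))) ht
    (Filter.Eventually.of_forall fun τ hτ => hg τ (Set.Ioc_subset_Icc_self hτ))
    ((by fun_prop : Continuous fun τ : ℝ => A * Real.exp (-(a * τ))).intervalIntegrable _ _)
  rw [intervalIntegral.integral_const_mul] at h
  refine h.trans ?_
  calc A * ∫ τ in (0:ℝ)..t, Real.exp (-(a * τ)) ≤ A * (1 / a) :=
        mul_le_mul_of_nonneg_left (intervalIntegral_exp_decay_le ha) hA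
    _ = A / a := by ring

/-- Integration by parts in time against an exponentially decaying weight. -/
theorem abs_integral_mul_deriv_le_of_exp_decay {a t A M : ℝ} {g g' h h' : ℝ → ℝ}
    (ha : 0 < a) (ht : 0 ≤ t) (hA : 0 ≤ A) (hM : 0 ≤ M)
    (hg : ∀ τ ∈ Set.Icc 0 t, HasDerivAt g (g' τ) τ)
    (hh : ∀ τ ∈ Set.Icc 0 t, HasDerivAt h (h' τ) τ)
    (hg' : ContinuousOn g' (Set.Icc 0 t)) (hh' : ContinuousOn h' (Set.Icc 0 t))
    (hgM : ∀ τ ∈ Set.Icc 0 t, |g τ| ≤ M)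
    (hhA : ∀ τ ∈ Set.Icc 0 t, |h τ| ≤ A * Real.exp (-(a * τ)))
    (hhA' : ∀ τ ∈ Set.Icc 0 t, |h' τ| ≤ A * Real.exp (-(a * τ))) :
    |∫ τ in (0:ℝ)..t, h τ * g' τ| ≤ 2 * (A * M) + A * M / a := by
  rw [← Set.uIcc_of_le ht] at hg' hh'
  rw [intervalIntegral.integral_mul_deriv_eq_deriv_mul (u := h) (v := g) (u' := h') (v' := g')
    (fun τ hτ => hh τ (by rwa [Set.uIcc_of_le ht] at hτ))
    (fun τ hτ => hg τ (by rwa [Set.uIcc_of_le ht] at hτ))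
    hh'.intervalIntegrable hg'.intervalIntegrable]
  have hend : ∀ τ ∈ Set.Icc 0 t, |h τ * g τ| ≤ A * M := by
    intro τ hτ
    rw [abs_mul]
    refine mul_le_mul ((hhA τ hτ).trans ?_) (hgM τ hτ) (abs_nonneg _) hA
    exact mul_le_of_le_one_right hA
      (Real.exp_le_one_iff.2 (neg_nonpos.2 (mul_nonneg ha.le hτ.1)))
  have hI := abs_integral_le_of_exp_decay (g := fun τ => h' τ * g τ) ha ht (mul_nonneg hA hM)
    (fun τ hτ => by
      rw [abs_mul, mul_right_comm]
      exact mul_le_mul (hhA' τ hτ) (hgM τ hτ) (abs_nonneg _) (by positivity))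
  have h0 := hend 0 ⟨le_rfl, ht⟩
  have h1 := hend t ⟨ht, le_rfl⟩
  rw [abs_le] at *
  constructor <;> linarith [h0.1, h0.2, h1.1, h1.2, hI.1, hI.2]

/-- A monotone profile stays between its limits at `±∞`. -/
theorem profile_mem_Icc {V : ℝ → ℝ} {vm vp K c : ℝ} (hc : 0 < c) (hV : Monotone V)
    (hm : ∀ ξ ≤ (0:ℝ), |V ξ - vm| ≤ K * Real.exp (c * ξ))
    (hpl : ∀ ξ ≥ (0:ℝ), |V ξ - vp| ≤ K * Real.exp (-(c * ξ))) (ξ : ℝ) :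
    V ξ ∈ Set.Icc vm vp := by
  have htop : Tendsto (fun ξ : ℝ => c * ξ) atTop atTop := tendsto_id.const_mul_atTop hc
  have hbot : Tendsto (fun ξ : ℝ => c * ξ) atBot atBot := tendsto_id.const_mul_atBot hc
  have lm : Tendsto V atBot (nhds vm) := by
    rw [tendsto_iff_norm_sub_tendsto_zero]
    refine squeeze_zero' (Filter.Eventually.of_forall fun _ => norm_nonneg _)
      (Filter.eventually_atBot.2 ⟨0, fun ξ hξ => hm ξ hξ⟩) ?_
    simpa using (Real.tendsto_exp_atBot.comp hbot).const_mul K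
  have lp : Tendsto V atTop (nhds vp) := by
    rw [tendsto_iff_norm_sub_tendsto_zero]
    refine squeeze_zero' (Filter.Eventually.of_forall fun _ => norm_nonneg _)
      (Filter.eventually_atTop.2 ⟨0, fun ξ hξ => hpl ξ hξ⟩) ?_
    simpa using (Real.tendsto_exp_neg_atTop_nhds_zero.comp htop).const_mul K
  exact ⟨hV.le_of_tendsto lm ξ, hV.ge_of_tendsto lp ξ⟩

/-- Boundary estimates (second group), involving the Korteweg capillarity terms: the boundary terms built from `φ_xx` are bounded by `C e^{−c₁β}`. -/
theorem boundary_estimates_second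
    (p : ℝ → ℝ) (μ κ s c₁ C₁ vm vp : ℝ)
    (hp : ContDiffOn ℝ (⊤ : ℕ∞) p (Set.Ioi 0))
    (hp1 : ∀ v > (0:ℝ), deriv p v < 0)
    (hp2 : ∀ v > (0:ℝ), deriv (deriv p) v > 0)
    (hμ : 0 < μ) (hκ : 0 < κ) (hs : 0 < s) (hc₁ : 0 < c₁) (hC₁ : 0 < C₁)
    (hvm : 0 < vm) (hvmvp : vm < vp) :
    ∃ δ₀ > 0, ∃ ε₀ > 0, ∃ C > 0,
      ∀ (up α β T ε : ℝ) (V U : ℝ → ℝ) (φ ψ : ℝ → ℝ → ℝ),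
        up < 0 → |α| < 1 → 1 < β → 0 < T → 0 < ε → ε < 1 →
        ContDiff ℝ (⊤ : ℕ∞) V → ContDiff ℝ (⊤ : ℕ∞) U →
        (∀ ξ : ℝ, s * V ξ + U ξ = s * vm) →
        (∀ ξ : ℝ, μ * deriv U ξ / V ξ - κ * deriv (deriv V) ξ / (V ξ) ^ 5
            + (5 * κ / 2) * (deriv V ξ) ^ 2 / (V ξ) ^ 6
          = -(s * U ξ) + p (V ξ) - p vm) →
        (∀ ξ : ℝ, 0 < deriv V ξ) → (∀ ξ : ℝ, deriv U ξ < 0) →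
        (∀ ξ ≤ (0:ℝ), |V ξ - vm| + |U ξ| ≤ C₁ * (vp - vm) * Real.exp (c₁ * ξ)) →
        (∀ ξ ≥ (0:ℝ), |V ξ - vp| + |U ξ - up| ≤ C₁ * (vp - vm) * Real.exp (-(c₁ * ξ))) →
        (∀ ξ : ℝ, |deriv V ξ| + |deriv U ξ|
          ≤ C₁ * (vp - vm) ^ 2 * Real.exp (-(c₁ * |ξ|))) →
        (∀ ξ : ℝ, |deriv (deriv V) ξ| + |deriv (deriv U) ξ|
          ≤ C₁ * (vp - vm) ^ 2 * Real.exp (-(c₁ * |ξ|))) →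
        (∀ ξ : ℝ, |deriv (deriv (deriv V)) ξ| + |deriv (deriv (deriv U)) ξ|
          ≤ C₁ * (vp - vm) ^ 2 * Real.exp (-(c₁ * |ξ|))) →
        ContDiff ℝ (⊤ : ℕ∞) (Function.uncurry φ) →
        ContDiff ℝ (⊤ : ℕ∞) (Function.uncurry ψ) →
        (∀ t ∈ Set.Icc (0:ℝ) T, ∀ j ≤ 4,
          IntegrableOn (fun x => (pdx^[j] φ x t) ^ 2) (Set.Ioi 0) ∧
          Tendsto (fun x => pdx^[j] φ x t) atTop (nhds 0)) →
        (∀ t ∈ Set.Icc (0:ℝ) T, ∀ j ≤ 3,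
          IntegrableOn (fun x => (pdx^[j] ψ x t) ^ 2) (Set.Ioi 0) ∧
          Tendsto (fun x => pdx^[j] ψ x t) atTop (nhds 0)) →
        (∀ x ≥ (0:ℝ), ∀ t ∈ Set.Icc (0:ℝ) T,
          vm / 2 ≤ V (x - s * t + α - β) + pdx φ x t ∧
          V (x - s * t + α - β) + pdx φ x t ≤ 3 / 2 * vp) →
        (∀ x ∈ Set.Ioi (0:ℝ), ∀ t ∈ Set.Ioo (0:ℝ) T, pdt φ x t - pdx ψ x t = 0) →
        (∀ x ∈ Set.Ioi (0:ℝ), ∀ t ∈ Set.Ioo (0:ℝ) T,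
          pdt ψ x t + deriv p (V (x - s * t + α - β)) * pdx φ x t
            - μ / V (x - s * t + α - β) * pdx (pdx ψ) x t
            + κ * pdx (pdx (pdx φ)) x t / (V (x - s * t + α - β) + pdx φ x t) ^ 5
            + μ * deriv U (x - s * t + α - β) * pdx φ x t / (V (x - s * t + α - β)) ^ 2
          = NSKF p μ κ s α β V U φ ψ x t) →
        (∀ t ∈ Set.Icc (0:ℝ) T, φ 0 t = ∫ τ in Set.Ici t, U (-(s * τ) + α - β)) →
        (∀ t ∈ Set.Icc (0:ℝ) T, pdx ψ 0 t = -U (-(s * t) + α - β)) →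
        (∀ t ∈ Set.Icc (0:ℝ) T,
          pdx (pdx φ) 0 t = (s ^ 2)⁻¹ * (s * deriv U (-(s * t) + α - β))) →
        (∀ t ∈ Set.Icc (0:ℝ) T, Real.sqrt (Hsq 3 φ t) + Real.sqrt (Hsq 2 ψ t) ≤ ε) →
        vp - vm ≤ δ₀ → ε ≤ ε₀ →
        ∀ t ∈ Set.Icc (0:ℝ) T,
          |∫ τ in (0:ℝ)..t, pdx (pdx φ) 0 τ * ψ 0 τ /
              (deriv p (V (-(s * τ) + α - β)) * (V (-(s * τ) + α - β) + pdx φ 0 τ) ^ 5)| +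
          |∫ τ in (0:ℝ)..t, pdx φ 0 τ * pdx (pdx φ) 0 τ /
              (V (-(s * τ) + α - β) + pdx φ 0 τ) ^ 5| +
          |∫ τ in (0:ℝ)..t, pdx (pdx φ) 0 τ * pdx (pdx ψ) 0 τ /
              (V (-(s * τ) + α - β) + pdx φ 0 τ) ^ 5| +
          |∫ τ in (0:ℝ)..t, pdt ψ 0 τ * pdx (pdx φ) 0 τ|
            ≤ C * Real.exp (-(c₁ * β)) := by
  obtain ⟨m, hm, hpm⟩ : ∃ m > 0, ∀ v ∈ Set.Icc vm vp, m ≤ |deriv p v| := by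
    have hcont : ContinuousOn (fun v => |deriv p v|) (Set.Icc vm vp) :=
      ((hp.continuousOn_deriv_of_isOpen isOpen_Ioi (by simp)).mono
        fun v hv => hvm.trans_le hv.1).abs
    obtain ⟨v, hv, hmin⟩ := isCompact_Icc.exists_isMinOn ⟨vm, le_rfl, hvmvp.le⟩ hcont
    exact ⟨_, abs_pos.2 (hp1 v (hvm.trans_le hv.1)).ne, fun w hw => hmin hw⟩
  set D := C₁ * (vp - vm) ^ 2 * Real.exp c₁ with hD
  have hvv : 0 < vp - vm := sub_pos.2 hvmvp
  have hDpos : 0 < D := by positivity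
  set a := c₁ * s with ha
  have hapos : 0 < a := by positivity
  set L := vm / 2 with hL
  have hLpos : 0 < L := by positivity
  set M := 1 / (4 * L ^ 4) with hM
  have hMpos : 0 < M := by positivity
  set B := D + D / s with hB
  have hBpos : 0 < B := by positivity
  refine ⟨1, one_pos, 1, one_pos,
    B * (1 / (m * L ^ 5) / a + 1 / L ^ 5 / a + (2 * M + M / a + s * D / L ^ 5 / a)
      + (2 + 1 / a)), by positivity, ?_⟩
  intro up α β T ε V U φ ψ _ hα hβ hT _ hε1 hV hU _ _ hV' _ hminus hplus hd1 hd2 _ hφ hψ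
    hφint hψint hv hcons _ _ _ hφxx hN _ _ t ht
  set E := Real.exp (-(c₁ * β)) with hE
  have hEpos : 0 < E := Real.exp_pos _
  set ζ : ℝ → ℝ := fun τ => -(s * τ) + α - β with hζ
  have hζd : ∀ τ, HasDerivAt ζ (-s) τ := fun τ => by
    exact ((((hasDerivAt_id τ).const_mul s).fun_neg.add_const α).sub_const β).congr_deriv
      (by simp)
  have hsub : Set.Icc 0 t ⊆ Set.Icc 0 T := Set.Icc_subset_Icc_right ht.2
  -- decay of the profile derivatives along the boundary
  have hexp : ∀ τ ≥ (0:ℝ), C₁ * (vp - vm) ^ 2 * Real.exp (-(c₁ * |ζ τ|))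
      ≤ D * E * Real.exp (-(a * τ)) := by
    intro τ hτ
    have hα' := abs_lt.1 hα
    have hneg : ζ τ ≤ 0 := by
      have := mul_nonneg hs.le hτ
      simp only [hζ]; linarith
    rw [abs_of_nonpos hneg, hD, hE, mul_assoc (C₁ * (vp - vm) ^ 2 * _), ← Real.exp_add,
      mul_assoc (C₁ * (vp - vm) ^ 2), ← Real.exp_add]
    refine mul_le_mul_of_nonneg_left (Real.exp_le_exp.2 ?_) (by positivity)
    simp only [hζ, ha]
    nlinarith
  have hU1 : ∀ τ ≥ (0:ℝ), |deriv U (ζ τ)| ≤ D * E * Real.exp (-(a * τ)) := fun τ hτ =>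
    (le_add_of_nonneg_left (abs_nonneg _)).trans ((hd1 _).trans (hexp τ hτ))
  have hU2 : ∀ τ ≥ (0:ℝ), |deriv (deriv U) (ζ τ)| ≤ D * E * Real.exp (-(a * τ)) :=
    fun τ hτ => (le_add_of_nonneg_left (abs_nonneg _)).trans ((hd2 _).trans (hexp τ hτ))
  have hV1 : ∀ τ ≥ (0:ℝ), |deriv V (ζ τ)| ≤ D := by
    intro τ hτ
    refine (le_add_of_nonneg_right (abs_nonneg _)).trans ((hd1 _).trans ?_)
    rw [hD]
    refine mul_le_mul_of_nonneg_left (Real.exp_le_exp.2 ?_) (by positivity)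
    have := mul_nonneg hc₁.le (abs_nonneg (ζ τ))
    linarith
  -- the boundary datum `φ_xx(0,τ)` and its time derivative
  set h : ℝ → ℝ := fun τ => (s ^ 2)⁻¹ * (s * deriv U (ζ τ)) with hh
  have hDE : D / s ≤ B ∧ D ≤ B := by
    have : 0 < D / s := by positivity
    constructor <;> linarith
  have hhA : ∀ τ ∈ Set.Icc 0 t, |h τ| ≤ B * E * Real.exp (-(a * τ)) := by
    intro τ hτ
    have : h τ = deriv U (ζ τ) / s := by simp only [hh]; field_simp
    rw [this, abs_div, abs_of_pos hs, div_le_iff₀ hs]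
    refine (hU1 τ hτ.1).trans ?_
    have h2 : D ≤ B * s := (div_le_iff₀ hs).1 hDE.1
    calc D * E * Real.exp (-(a * τ)) ≤ (B * s) * E * Real.exp (-(a * τ)) := by gcongr
      _ = _ := by ring
  have hUd : ContDiff ℝ (⊤ : ℕ∞) (deriv U) := (contDiff_infty_iff_deriv.1 hU).2
  have hhd : ∀ τ, HasDerivAt h (-deriv (deriv U) (ζ τ)) τ := by
    intro τ
    have h1 : HasDerivAt (deriv U) (deriv (deriv U) (ζ τ)) (ζ τ) :=
      (hUd.differentiable (by simp) _).hasDerivAt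
    exact (((h1.comp τ (hζd τ)).const_mul s).const_mul ((s ^ 2)⁻¹)).congr_deriv
      (by field_simp)
  have hhA' : ∀ τ ∈ Set.Icc 0 t,
      |-deriv (deriv U) (ζ τ)| ≤ B * E * Real.exp (-(a * τ)) := by
    intro τ hτ
    rw [abs_neg]
    refine (hU2 τ hτ.1).trans ?_
    have := hDE.2
    gcongr
  have hζc : Continuous ζ := by simp only [hζ]; fun_prop
  have hhc' : Continuous fun τ => -deriv (deriv U) (ζ τ) :=
    ((hUd.continuous_deriv (by simp)).comp hζc).neg
  -- pointwise bounds on the boundary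
  have hHle : ∀ τ ∈ Set.Icc 0 t, Hsq 3 φ τ ≤ 1 ∧ Hsq 2 ψ τ ≤ 1 := by
    intro τ hτ
    have h1 := hN τ (hsub hτ)
    have h2 := Real.sqrt_nonneg (Hsq 3 φ τ)
    have h3 := Real.sqrt_nonneg (Hsq 2 ψ τ)
    exact ⟨Real.sqrt_le_one.1 (by linarith), Real.sqrt_le_one.1 (by linarith)⟩
  have hψ1 : ∀ τ ∈ Set.Icc 0 t, |ψ 0 τ| ≤ 1 := fun τ hτ =>
    abs_pdx_iterate_zero_le_one (j := 0) (k := 2) (by norm_num) hψ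
      (hψint τ (hsub hτ) 0 (by norm_num)).1 (hψint τ (hsub hτ) 1 (by norm_num)).1
      (hψint τ (hsub hτ) 0 (by norm_num)).2 (hHle τ hτ).2
  have hφ1 : ∀ τ ∈ Set.Icc 0 t, |pdx φ 0 τ| ≤ 1 := fun τ hτ =>
    abs_pdx_iterate_zero_le_one (j := 1) (k := 3) (by norm_num) (contDiff_pdx hφ)
      (hφint τ (hsub hτ) 1 (by norm_num)).1 (hφint τ (hsub hτ) 2 (by norm_num)).1
      (hφint τ (hsub hτ) 1 (by norm_num)).2 (hHle τ hτ).1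
  set w : ℝ → ℝ := fun τ => V (ζ τ) + pdx φ 0 τ with hw
  have hwL : ∀ τ ∈ Set.Icc 0 t, L ≤ w τ := by
    intro τ hτ
    have := (hv 0 le_rfl τ (hsub hτ)).1
    rwa [zero_sub] at this
  have hVmem : ∀ ξ, V ξ ∈ Set.Icc vm vp :=
    profile_mem_Icc hc₁ (strictMono_of_deriv_pos hV').monotone
      (fun ξ hξ => (le_add_of_nonneg_right (abs_nonneg _)).trans (hminus ξ hξ))
      (fun ξ hξ => (le_add_of_nonneg_right (abs_nonneg _)).trans (hplus ξ hξ))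
  have ht0 := ht.1
  have hcongr : ∀ f g : ℝ → ℝ, (∀ τ ∈ Set.Icc 0 t, f τ = g τ) →
      ∫ τ in (0:ℝ)..t, f τ = ∫ τ in (0:ℝ)..t, g τ := fun f g hfg =>
    intervalIntegral.integral_congr fun τ hτ => hfg τ (by rwa [Set.uIcc_of_le ht0] at hτ)
  have hφxx' : ∀ τ ∈ Set.Icc 0 t, pdx (pdx φ) 0 τ = h τ := fun τ hτ => hφxx τ (hsub hτ)
  have hdiv : ∀ τ ∈ Set.Icc 0 t, ∀ x d r : ℝ, 0 < r → r ≤ |d| → |x| ≤ 1 →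
      |h τ * x / d| ≤ B * E * (1 / r) * Real.exp (-(a * τ)) := by
    intro τ hτ x d r hr hrd hx
    rw [abs_div, abs_mul]
    calc |h τ| * |x| / |d| ≤ (B * E * Real.exp (-(a * τ))) * 1 / r := by
          have := hhA τ hτ
          gcongr
      _ = _ := by ring
  have hw5 : ∀ τ ∈ Set.Icc 0 t, L ^ 5 ≤ |w τ ^ 5| := by
    intro τ hτ
    rw [abs_of_pos (pow_pos (hLpos.trans_le (hwL τ hτ)) 5)]
    exact pow_le_pow_left₀ hLpos.le (hwL τ hτ) 5
  have term1 : |∫ τ in (0:ℝ)..t, pdx (pdx φ) 0 τ * ψ 0 τ / (deriv p (V (ζ τ)) * w τ ^ 5)|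
      ≤ B * E * (1 / (m * L ^ 5)) / a := by
    refine abs_integral_le_of_exp_decay hapos ht0 (by positivity) fun τ hτ => ?_
    rw [hφxx' τ hτ]
    refine hdiv τ hτ _ _ _ (by positivity) ?_ (hψ1 τ hτ)
    rw [abs_mul]
    exact mul_le_mul (hpm _ (hVmem _)) (hw5 τ hτ) (by positivity) (abs_nonneg _)
  have term2 : |∫ τ in (0:ℝ)..t, pdx φ 0 τ * pdx (pdx φ) 0 τ / w τ ^ 5|
      ≤ B * E * (1 / L ^ 5) / a := by
    refine abs_integral_le_of_exp_decay hapos ht0 (by positivity) fun τ hτ => ?_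
    rw [hφxx' τ hτ, mul_comm (pdx φ 0 τ)]
    exact hdiv τ hτ _ _ _ (by positivity) (hw5 τ hτ) (hφ1 τ hτ)
  have term4 : |∫ τ in (0:ℝ)..t, pdt ψ 0 τ * pdx (pdx φ) 0 τ|
      ≤ 2 * (B * E * 1) + B * E * 1 / a := by
    rw [hcongr _ (fun τ => h τ * pdt ψ 0 τ) fun τ hτ => by rw [hφxx' τ hτ, mul_comm]]
    exact abs_integral_mul_deriv_le_of_exp_decay hapos ht0 (by positivity) one_pos.le
      (fun τ _ => (hasDerivAt_pdt hψ 0 τ).differentiableAt.hasDerivAt) (fun τ _ => hhd τ)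
      ((contDiff_pdt hψ).continuous.comp
        (by fun_prop : Continuous fun τ : ℝ => ((0:ℝ), τ))).continuousOn
      hhc'.continuousOn hψ1 hhA hhA'
  -- `φ_xt / v⁵` is a time derivative up to a profile term
  set y : ℝ → ℝ := fun τ => pdt (pdx φ) 0 τ with hy
  have hyc : Continuous y := (contDiff_pdt (contDiff_pdx hφ)).continuous.comp
    (by fun_prop : Continuous fun τ : ℝ => ((0:ℝ), τ))
  have hVc : Continuous fun τ => deriv V (ζ τ) := (hV.continuous_deriv (by simp)).comp hζc
  have hwd : ∀ τ, HasDerivAt w (deriv V (ζ τ) * -s + y τ) τ := fun τ =>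
    (((hV.differentiable (by simp) _).hasDerivAt).comp τ (hζd τ)).add
      (hasDerivAt_pdt (contDiff_pdx hφ) 0 τ).differentiableAt.hasDerivAt
  have hwc : Continuous w := continuous_iff_continuousAt.2 fun τ => (hwd τ).continuousAt
  have hwne : ∀ τ ∈ Set.Icc 0 t, w τ ≠ 0 := fun τ hτ => (hLpos.trans_le (hwL τ hτ)).ne'
  set g' : ℝ → ℝ := fun τ => (deriv V (ζ τ) * -s + y τ) / w τ ^ 5 with hg'
  have hgd : ∀ τ ∈ Set.Icc 0 t, HasDerivAt (fun τ => -(1 / (4 * w τ ^ 4))) (g' τ) τ := by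
    intro τ hτ
    have hne := hwne τ hτ
    have h1 := ((((hwd τ).fun_pow 4).const_mul 4).fun_inv (by positivity)).fun_neg
    simp only [one_div]
    refine h1.congr_deriv ?_
    simp only [hg']
    field_simp
    norm_num
    ring
  have hg'c : ContinuousOn g' (Set.Icc 0 t) :=
    ContinuousOn.div (by fun_prop) (by fun_prop) fun τ hτ => pow_ne_zero 5 (hwne τ hτ)
  have hhc : Continuous h := continuous_iff_continuousAt.2 fun τ => (hhd τ).continuousAt
  have hrc : ContinuousOn (fun τ => h τ * (s * deriv V (ζ τ)) / w τ ^ 5) (Set.Icc 0 t) :=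
    ContinuousOn.div (by fun_prop) (by fun_prop) fun τ hτ => pow_ne_zero 5 (hwne τ hτ)
  have term3 : |∫ τ in (0:ℝ)..t, pdx (pdx φ) 0 τ * pdx (pdx ψ) 0 τ / w τ ^ 5|
      ≤ (2 * (B * E * M) + B * E * M / a) + B * E * (s * D / L ^ 5) / a := by
    rw [hcongr _ (fun τ => h τ * g' τ + h τ * (s * deriv V (ζ τ)) / w τ ^ 5) fun τ hτ => by
      rw [hφxx' τ hτ, ← pdt_pdx_eq_of_conservation hT hφ hψ hcons (hsub hτ)]
      simp only [hg', hy]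
      ring]
    rw [← Set.uIcc_of_le ht0] at hrc
    have hhg : ContinuousOn (fun τ => h τ * g' τ) (Set.uIcc 0 t) :=
      hhc.continuousOn.mul (by rwa [Set.uIcc_of_le ht0])
    rw [intervalIntegral.integral_add hhg.intervalIntegrable hrc.intervalIntegrable]
    refine (abs_add_le _ _).trans (add_le_add ?_ ?_)
    · refine abs_integral_mul_deriv_le_of_exp_decay hapos ht0 (by positivity) hMpos.le hgd
        (fun τ _ => hhd τ) hg'c hhc'.continuousOn (fun τ hτ => ?_) hhA hhA'
      have := hwL τ hτ
      have hwpos := hLpos.trans_le this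
      rw [abs_neg, abs_of_pos (by positivity)]
      simp only [hM]
      gcongr
    · refine abs_integral_le_of_exp_decay hapos ht0 (by positivity) fun τ hτ => ?_
      rw [abs_div, abs_mul (h τ), abs_mul s, abs_of_pos hs]
      calc |h τ| * (s * |deriv V (ζ τ)|) / |w τ ^ 5|
          ≤ (B * E * Real.exp (-(a * τ))) * (s * D) / L ^ 5 := by
            have h1 := hhA τ hτ
            have h2 := hV1 τ hτ.1
            have h3 := hw5 τ hτ
            gcongr
        _ = _ := by ring
  refine (add_le_add (add_le_add (add_le_add term1 term2) term3) term4).trans (le_of_eq ?_)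
  ring
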